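/- arXiv:0909.5674 — 2 statements merged into one kernel-verified Lean document; each statement's English description precedes it below -/
import Mathlib

section
/- A value ≤ 1 suffices for existence (Lemma 3.13): Suppose η ≠ 0 or μ ≠ 0, and suppose |t| ≠ 1. If there exist d > 0 and a solution ψ of the model Lichnerowicz equation L_d with ψ(0) ≤ 1, then there exist d' > 0 and a solution ψ' of L_{d'} with ψ'(0) = 1. -/
open Real Filter

/-- The 2π-periodic function equal to −1 on (−π,0) and 1 on (0,π). -/
noncomputable def lam (x : ℝ) : ℝ := if 0 < Real.sin x then 1 else -1

/-- The critical exponent q = 2n/(n−2). -/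
noncomputable def qex (n : ℕ) : ℝ := 2 * n / ((n : ℝ) - 2)

/-- The coupling constant κ = (n−1)/n. -/
noncomputable def kap (n : ℕ) : ℝ := ((n : ℝ) - 1) / n

/-- A solution of the model Lichnerowicz equation `L_d` with parameters t, γ, η, μ:
a 2π-periodic, positive, C¹ function, twice differentiable off the multiples of π,
satisfying the equation there. -/
def IsModelSolution (n : ℕ) (t γ η μ d : ℝ) (ψ : ℝ → ℝ) : Prop :=
  (∀ x, ψ (x + 2 * Real.pi) = ψ x) ∧
  (∀ x, 0 < ψ x) ∧
  ContDiff ℝ 1 ψ ∧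
  ∀ x : ℝ, (∀ k : ℤ, x ≠ (k : ℝ) * Real.pi) →
    DifferentiableAt ℝ (deriv ψ) x ∧
    -2 * kap n * qex n * d ^ (-(qex n - 2)) * deriv (deriv ψ) x
      - 2 * η ^ 2 * d ^ (-(2 * qex n)) * ψ x ^ (-qex n - 1)
      - kap n * (μ * d ^ (-qex n) + γ + lam x) ^ 2 * ψ x ^ (-qex n - 1)
      + kap n * (t + lam x) ^ 2 * ψ x ^ (qex n - 1) = 0

open Topology

/-- `u` is `2π`-periodic and `C¹` with derivative `v`, and `v` has derivative `w` off the
multiples of `π`. -/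
structure IsPeriodicC1 (u v w : ℝ → ℝ) : Prop where
  periodic : Function.Periodic u (2 * π)
  hasDerivAt : ∀ x, HasDerivAt u (v x) x
  continuous_deriv : Continuous v
  hasDerivAt_deriv : ∀ x, sin x ≠ 0 → HasDerivAt v (w x) x

lemma IsPeriodicC1.continuous {u v w : ℝ → ℝ} (h : IsPeriodicC1 u v w) : Continuous u :=
  continuous_iff_continuousAt.2 fun x => (h.hasDerivAt x).continuousAt

lemma IsPeriodicC1.sub {u₁ v₁ w₁ u₂ v₂ w₂ : ℝ → ℝ} (h₁ : IsPeriodicC1 u₁ v₁ w₁)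
    (h₂ : IsPeriodicC1 u₂ v₂ w₂) :
    IsPeriodicC1 (fun x => u₁ x - u₂ x) (fun x => v₁ x - v₂ x) (fun x => w₁ x - w₂ x) where
  periodic x := by simp only [h₁.periodic x, h₂.periodic x]
  hasDerivAt x := (h₁.hasDerivAt x).sub (h₂.hasDerivAt x)
  continuous_deriv := h₁.continuous_deriv.sub h₂.continuous_deriv
  hasDerivAt_deriv x hx := (h₁.hasDerivAt_deriv x hx).sub (h₂.hasDerivAt_deriv x hx)

lemma IsPeriodicC1.const_mul {u v w : ℝ → ℝ} (h : IsPeriodicC1 u v w) (c : ℝ) :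
    IsPeriodicC1 (fun x => c * u x) (fun x => c * v x) (fun x => c * w x) where
  periodic x := by simp only [h.periodic x]
  hasDerivAt x := (h.hasDerivAt x).const_mul c
  continuous_deriv := continuous_const.mul h.continuous_deriv
  hasDerivAt_deriv x hx := (h.hasDerivAt_deriv x hx).const_mul c

lemma isPeriodicC1_const (c : ℝ) : IsPeriodicC1 (fun _ => c) (fun _ => 0) (fun _ => 0) where
  periodic _ := rfl
  hasDerivAt x := hasDerivAt_const x c
  continuous_deriv := continuous_const
  hasDerivAt_deriv x _ := hasDerivAt_const x 0

lemma IsPeriodicC1.congr {u v w w' : ℝ → ℝ} (h : IsPeriodicC1 u v w)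
    (hw : ∀ x, sin x ≠ 0 → w x = w' x) : IsPeriodicC1 u v w' where
  periodic := h.periodic
  hasDerivAt := h.hasDerivAt
  continuous_deriv := h.continuous_deriv
  hasDerivAt_deriv x hx := hw x hx ▸ h.hasDerivAt_deriv x hx

lemma exists_sin_ne_zero_right (x : ℝ) : ∃ z, x < z ∧ ∀ y ∈ Set.Ioo x z, sin y ≠ 0 := by
  refine ⟨(⌊x / π⌋ + 1 : ℝ) * π, ?_, ?_⟩
  · rw [← div_lt_iff₀ pi_pos]
    exact Int.lt_floor_add_one _
  · rintro y ⟨h1, h2⟩ h0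
    obtain ⟨k, rfl⟩ := sin_eq_zero_iff.1 h0
    have h3 : (⌊x / π⌋ : ℤ) < k := by
      rw [Int.floor_lt, div_lt_iff₀ pi_pos]
      exact h1
    have h4 : (k : ℝ) < ⌊x / π⌋ + 1 := lt_of_mul_lt_mul_right h2 pi_pos.le
    have h5 : k < ⌊x / π⌋ + 1 := by exact_mod_cast h4
    omega

/-- Maximum principle. -/
lemma IsPeriodicC1.nonpos {u v w : ℝ → ℝ} (h : IsPeriodicC1 u v w)
    (hw : ∀ x, sin x ≠ 0 → 0 < u x → 0 < w x) (x : ℝ) : u x ≤ 0 := by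
  have hc := h.continuous
  obtain ⟨x₀, -, hmax⟩ := (isCompact_Icc (a := (0 : ℝ)) (b := 2 * π)).exists_isMaxOn
    ⟨0, by constructor <;> [exact le_rfl; positivity]⟩ hc.continuousOn
  have hmax' : ∀ y, u y ≤ u x₀ := fun y => by
    obtain ⟨z, hz, hyz⟩ := h.periodic.exists_mem_Ico₀ (by positivity) y
    rw [hyz]
    exact hmax ⟨hz.1, hz.2.le⟩
  by_contra! hx
  have hx₀ : 0 < u x₀ := hx.trans_le (hmax' x)
  have hv : v x₀ = 0 :=
    IsLocalMax.hasDerivAt_eq_zero (Filter.Eventually.of_forall hmax') (h.hasDerivAt x₀)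
  obtain ⟨z, hz, hsin⟩ := exists_sin_ne_zero_right x₀
  obtain ⟨ε, hε, hpos⟩ := Metric.eventually_nhds_iff.1 (hc.continuousAt.eventually_const_lt hx₀)
  set y := min z (x₀ + ε)
  have hy : x₀ < y := lt_min hz (by linarith)
  have hmono : StrictMonoOn v (Set.Icc x₀ y) := by
    apply strictMonoOn_of_deriv_pos (convex_Icc _ _) h.continuous_deriv.continuousOn
    intro s hs
    rw [interior_Icc] at hs
    have hs' := hsin s ⟨hs.1, hs.2.trans_le (min_le_left _ _)⟩
    rw [(h.hasDerivAt_deriv s hs').deriv]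
    refine hw s hs' (hpos ?_)
    have := hs.2.trans_le (min_le_right _ _)
    rw [Real.dist_eq, abs_lt]
    constructor <;> linarith [hs.1]
  have hmono' : StrictMonoOn u (Set.Icc x₀ y) := by
    apply strictMonoOn_of_deriv_pos (convex_Icc _ _) hc.continuousOn
    intro s hs
    rw [interior_Icc] at hs
    rw [(h.hasDerivAt s).deriv, ← hv]
    exact hmono ⟨le_rfl, hy.le⟩ ⟨hs.1.le, hs.2.le⟩ hs.1
  exact absurd (hmono' ⟨le_rfl, hy.le⟩ ⟨hy.le, le_rfl⟩ hy) (hmax' y).not_gt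

lemma lam_eq_or (x : ℝ) : lam x = 1 ∨ lam x = -1 := by
  unfold lam
  split_ifs <;> simp

lemma lam_periodic : Function.Periodic lam (2 * π) := fun x => by
  simp only [lam, sin_add_two_pi]

lemma lam_eventuallyEq {x : ℝ} (hx : sin x ≠ 0) : ∀ᶠ y in 𝓝 x, lam y = lam x := by
  rcases hx.lt_or_gt with hx | hx
  · filter_upwards [continuous_sin.continuousAt.eventually_lt_const hx] with y hy
    simp [lam, hx.not_gt, hy.not_gt]
  · filter_upwards [continuous_sin.continuousAt.eventually_const_lt hx] with y hy
    simp [lam, hx, hy]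

/-- The primitive of the triangle wave `arcsin ∘ cos`, a periodic function with second
derivative `-lam`. -/
lemma exists_isPeriodicC1_neg_lam : ∃ p v, IsPeriodicC1 p v (fun x => -lam x) := by
  have hc : Continuous fun x => arcsin (cos x) := continuous_arcsin.comp continuous_cos
  have hint : ∀ a b, IntervalIntegrable (fun x => arcsin (cos x)) MeasureTheory.volume a b :=
    fun a b => hc.intervalIntegrable a b
  refine ⟨fun x => ∫ y in (0 : ℝ)..x, arcsin (cos y), fun x => arcsin (cos x), ?_, ?_, hc, ?_⟩
  · intro x
    have hper : Function.Periodic (fun x => arcsin (cos x)) (2 * π) := fun x => by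
      simp only [cos_add_two_pi]
    have h0 : ∫ y in (0 : ℝ)..(2 * π), arcsin (cos y) = 0 := by
      rw [← intervalIntegral.integral_add_adjacent_intervals (hint 0 π) (hint π (2 * π))]
      have := intervalIntegral.integral_comp_add_right (a := 0) (b := π)
        (fun y => arcsin (cos y)) π
      simp only [cos_add_pi, arcsin_neg, intervalIntegral.integral_neg, zero_add] at this
      rw [two_mul, ← this]
      ring
    have h1 := hper.intervalIntegral_add_eq x 0
    rw [zero_add, h0] at h1
    change ∫ y in (0 : ℝ)..(x + 2 * π), arcsin (cos y) = ∫ y in (0 : ℝ)..x, arcsin (cos y)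
    rw [← intervalIntegral.integral_add_adjacent_intervals (hint 0 x) (hint x (x + 2 * π)), h1,
      add_zero]
  · exact fun x => hc.integral_hasStrictDerivAt 0 x |>.hasDerivAt
  · intro x hx
    have hsq := sin_sq_add_cos_sq x
    have hpos : 0 < sin x ^ 2 := by positivity
    have h1 : cos x ≠ -1 := fun h => by rw [h] at hsq; linarith
    have h2 : cos x ≠ 1 := fun h => by rw [h] at hsq; linarith
    refine ((hasDerivAt_arcsin h1 h2).comp x (hasDerivAt_cos x)).congr_deriv ?_
    rw [show 1 - cos x ^ 2 = sin x ^ 2 by linarith, sqrt_sq_eq_abs]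
    rcases hx.lt_or_gt with hx | hx
    · rw [abs_of_neg hx]
      simp only [lam, hx.not_gt, if_false]
      field_simp
    · rw [abs_of_pos hx]
      simp only [lam, hx, if_true]
      field_simp

/-- Periodic solution of the first-order linear equation `f' = -k f + h`. -/
lemma exists_periodic_first_order {k : ℝ} (hk : k ≠ 0) {h : ℝ → ℝ}
    (hper : Function.Periodic h (2 * π))
    (hint : ∀ a b, IntervalIntegrable h MeasureTheory.volume a b)
    (hmeas : Measurable h) (hcont : ∀ x, sin x ≠ 0 → ContinuousAt h x) :
    ∃ f : ℝ → ℝ, Function.Periodic f (2 * π) ∧ Continuous f ∧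
      ∀ x, sin x ≠ 0 → HasDerivAt f (-k * f x + h x) x := by
  set e : ℝ → ℝ := fun y => exp (k * y)
  have he : Continuous e := by fun_prop
  have hint' : ∀ a b, IntervalIntegrable (fun y => e y * h y) MeasureTheory.volume a b :=
    fun a b => (hint a b).continuousOn_mul he.continuousOn
  set I : ℝ → ℝ := fun x => ∫ y in (0 : ℝ)..x, e y * h y
  have hE : exp (k * (2 * π)) - 1 ≠ 0 := by
    rw [sub_ne_zero, Ne, exp_eq_one_iff]
    have := pi_pos
    positivity
  have hI : ∀ x, I (x + 2 * π) = I (2 * π) + exp (k * (2 * π)) * I x := by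
    intro x
    have h1 : ∫ y in (0 : ℝ)..x, e (y + 2 * π) * h (y + 2 * π) =
        ∫ y in (2 * π)..(x + 2 * π), e y * h y := by
      rw [intervalIntegral.integral_comp_add_right (fun y => e y * h y), zero_add]
    have h2 : ∫ y in (0 : ℝ)..x, e (y + 2 * π) * h (y + 2 * π) = exp (k * (2 * π)) * I x := by
      rw [← intervalIntegral.integral_const_mul]
      congr 1
      ext y
      rw [hper y]
      simp only [e, mul_add, exp_add]
      ring
    rw [← h2, h1, intervalIntegral.integral_add_adjacent_intervals (hint' _ _) (hint' _ _)]
  set C := I (2 * π) / (exp (k * (2 * π)) - 1)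
  refine ⟨fun x => exp (-(k * x)) * (C + I x), fun x => ?_, ?_, fun x hx => ?_⟩
  · simp only [hI]
    have hC : I (2 * π) = C * (exp (k * (2 * π)) - 1) := (div_mul_cancel₀ _ hE).symm
    rw [hC, mul_add k, neg_add, exp_add, exp_neg (k * (2 * π))]
    have := exp_pos (k * (2 * π))
    field_simp
    ring
  · have : Continuous I := intervalIntegral.continuous_primitive hint' 0
    fun_prop
  · have hd : HasDerivAt I (e x * h x) x :=
      intervalIntegral.integral_hasDerivAt_right (hint' 0 x)
        ((he.measurable.mul hmeas).stronglyMeasurable.stronglyMeasurableAtFilter)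
        (he.continuousAt.mul (hcont x hx))
    have h1 : HasDerivAt (fun x => exp (-(k * x))) (exp (-(k * x)) * (-(k * 1))) x :=
      ((hasDerivAt_id x).const_mul k).neg.exp
    refine (h1.mul (hd.const_add C)).congr_deriv ?_
    simp only [e]
    rw [exp_neg]
    field_simp

lemma countable_sin_eq_zero : {x : ℝ | sin x = 0}.Countable := by
  refine (Set.countable_range fun k : ℤ => (k : ℝ) * π).mono fun x hx => ?_
  exact sin_eq_zero_iff.1 hx

lemma hasDerivAt_of_sin_ne_zero {u v : ℝ → ℝ} (hu : Continuous u) (hv : Continuous v)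
    (h : ∀ x, sin x ≠ 0 → HasDerivAt u (v x) x) (x : ℝ) : HasDerivAt u (v x) x := by
  have key : ∀ y, u y = u 0 + ∫ s in (0 : ℝ)..y, v s := fun y => by
    rw [MeasureTheory.integral_eq_of_hasDerivAt_off_countable u v countable_sin_eq_zero
      hu.continuousOn (fun s hs => h s hs.2) (hv.intervalIntegrable _ _)]
    ring
  rw [funext key]
  exact (hv.integral_hasStrictDerivAt 0 x).hasDerivAt.const_add _

/-- Periodic solution of the linear equation `u'' = k² u - h`. -/
lemma exists_periodic_second_order {k : ℝ} (hk : 0 < k) {h : ℝ → ℝ}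
    (hper : Function.Periodic h (2 * π))
    (hint : ∀ a b, IntervalIntegrable h MeasureTheory.volume a b)
    (hmeas : Measurable h) (hcont : ∀ x, sin x ≠ 0 → ContinuousAt h x) :
    ∃ u v, IsPeriodicC1 u v (fun x => k ^ 2 * u x - h x) := by
  obtain ⟨A, hA1, hA2, hA3⟩ := exists_periodic_first_order hk.ne' hper hint hmeas hcont
  obtain ⟨B, hB1, hB2, hB3⟩ := exists_periodic_first_order (neg_ne_zero.2 hk.ne')
    (h := fun x => -h x) (fun x => by simp only [hper x]) (fun a b => (hint a b).neg)
    hmeas.neg (fun x hx => (hcont x hx).neg)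
  have hu : ∀ x, sin x ≠ 0 →
      HasDerivAt (fun x => (A x + B x) / (2 * k)) ((B x - A x) / 2) x := fun x hx => by
    refine (((hA3 x hx).add (hB3 x hx)).div_const (2 * k)).congr_deriv ?_
    field_simp
    ring
  refine ⟨fun x => (A x + B x) / (2 * k), fun x => (B x - A x) / 2, fun x => ?_, fun x => ?_,
    by fun_prop, fun x hx => ?_⟩
  · simp only [hA1 x, hB1 x]
  · exact hasDerivAt_of_sin_ne_zero (by fun_prop) (by fun_prop) hu x
  · refine (((hB3 x hx).sub (hA3 x hx)).div_const 2).congr_deriv ?_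
    field_simp
    ring

lemma measurable_comp_lam {H : ℝ → ℝ → ℝ} (h₁ : Continuous (H 1)) (h₂ : Continuous (H (-1))) :
    Measurable fun x => H (lam x) x := by
  have : (fun x => H (lam x) x) = fun x => if 0 < sin x then H 1 x else H (-1) x := by
    ext x
    unfold lam
    split_ifs <;> rfl
  rw [this]
  exact Measurable.ite (measurableSet_lt measurable_const continuous_sin.measurable)
    h₁.measurable h₂.measurable

lemma intervalIntegrable_comp_lam {H : ℝ → ℝ → ℝ} (h₁ : Continuous (H 1))
    (h₂ : Continuous (H (-1))) (a b : ℝ) :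
    IntervalIntegrable (fun x => H (lam x) x) MeasureTheory.volume a b := by
  refine IntervalIntegrable.mono_fun' (g := fun x => |H 1 x| + |H (-1) x|)
    ((h₁.abs.add h₂.abs).intervalIntegrable a b)
    (measurable_comp_lam h₁ h₂).aestronglyMeasurable (Eventually.of_forall fun x => ?_)
  have := abs_nonneg (H 1 x)
  have := abs_nonneg (H (-1) x)
  rcases lam_eq_or x with h | h <;> simp only [h, Real.norm_eq_abs] <;> linarith

lemma continuousAt_comp_lam {H : ℝ → ℝ → ℝ} (h₁ : Continuous (H 1)) (h₂ : Continuous (H (-1)))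
    {x : ℝ} (hx : sin x ≠ 0) : ContinuousAt (fun x => H (lam x) x) x := by
  have : ContinuousAt (H (lam x)) x := by
    rcases lam_eq_or x with h | h <;> rw [h]
    · exact h₁.continuousAt
    · exact h₂.continuousAt
  refine this.congr ?_
  filter_upwards [lam_eventuallyEq hx] with y hy
  rw [hy]

lemma IsPeriodicC1.exists_abs_le {u v w : ℝ → ℝ} (h : IsPeriodicC1 u v w) :
    ∃ C, ∀ x, |u x| ≤ C := by
  obtain ⟨C, hC⟩ := (isCompact_Icc (a := (0 : ℝ)) (b := 2 * π)).exists_bound_of_continuousOn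
    h.continuous.continuousOn
  refine ⟨C, fun x => ?_⟩
  obtain ⟨z, hz, hxz⟩ := h.periodic.exists_mem_Ico₀ (by positivity) x
  rw [hxz]
  exact hC z ⟨hz.1, hz.2.le⟩

/-- A periodic solution of `u'' = -F(lam, u)` for a uniformly decreasing Lipschitz
nonlinearity `F`. -/
lemma exists_periodic_of_lipschitz (F : ℝ → ℝ → ℝ) {σ L : ℝ} (hσ : 0 < σ)
    (hF : ∀ s, s = 1 ∨ s = -1 → ∀ y z, y ≤ z →
      σ * (z - y) ≤ F s y - F s z ∧ F s y - F s z ≤ L * (z - y)) :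
    ∃ u v, IsPeriodicC1 u v (fun x => -F (lam x) (u x)) := by
  have hσL : σ ≤ L := by
    have := hF 1 (Or.inl rfl) 0 1 zero_le_one
    linarith
  have hL : 0 < L := hσ.trans_le hσL
  have hFc : ∀ s, s = 1 ∨ s = -1 → Continuous (F s) := fun s hs => by
    refine (LipschitzWith.of_dist_le_mul (K := L.toNNReal) fun y z => ?_).continuous
    simp only [Real.dist_eq, Real.coe_toNNReal L hL.le]
    rcases le_total y z with hyz | hyz
    · have := hF s hs y z hyz
      have h0 : 0 ≤ σ * (z - y) := mul_nonneg hσ.le (by linarith)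
      rw [abs_of_nonneg (by linarith), abs_sub_comm, abs_of_nonneg (by linarith)]
      exact this.2
    · have := hF s hs z y hyz
      have h0 : 0 ≤ σ * (y - z) := mul_nonneg hσ.le (by linarith)
      rw [abs_sub_comm, abs_of_nonneg (by linarith), abs_of_nonneg (by linarith)]
      exact this.2
  have hlin : ∀ f : BoundedContinuousFunction ℝ ℝ, Function.Periodic f (2 * π) →
      ∃ u v, IsPeriodicC1 u v (fun x => L * u x - (L * f x + F (lam x) (f x))) := by
    intro f hf
    have h₁ : Continuous fun x => L * f x + F 1 (f x) :=
      (continuous_const.mul f.continuous).add ((hFc 1 (Or.inl rfl)).comp f.continuous)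
    have h₂ : Continuous fun x => L * f x + F (-1) (f x) :=
      (continuous_const.mul f.continuous).add ((hFc (-1) (Or.inr rfl)).comp f.continuous)
    have := exists_periodic_second_order (sqrt_pos.2 hL)
      (h := fun x => L * f x + F (lam x) (f x))
      (fun x => by simp only [hf x, lam_periodic x])
      (intervalIntegrable_comp_lam (H := fun s x => L * f x + F s (f x)) h₁ h₂)
      (measurable_comp_lam (H := fun s x => L * f x + F s (f x)) h₁ h₂)
      (fun x hx => continuousAt_comp_lam (H := fun s x => L * f x + F s (f x)) h₁ h₂ hx)
    simpa only [sq_sqrt hL.le] using this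
  let X := {f : BoundedContinuousFunction ℝ ℝ // Function.Periodic f (2 * π)}
  have hX : IsClosed {f : BoundedContinuousFunction ℝ ℝ | Function.Periodic f (2 * π)} := by
    simp only [Function.Periodic, Set.ofPred_forall]
    exact isClosed_iInter fun x => isClosed_eq
      (continuous_eval_const (x + 2 * π)) (continuous_eval_const x)
  have : CompleteSpace X := hX.completeSpace_coe
  have : Nonempty X := ⟨⟨0, fun _ => rfl⟩⟩
  have hT : ∀ f : X, ∃ g : X, ∃ v,
      IsPeriodicC1 g.1 v (fun x => L * g.1 x - (L * f.1 x + F (lam x) (f.1 x))) := by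
    rintro ⟨f, hf⟩
    obtain ⟨u, v, huv⟩ := hlin f hf
    obtain ⟨C, hC⟩ := huv.exists_abs_le
    exact ⟨⟨BoundedContinuousFunction.ofNormedAddCommGroup u huv.continuous C hC, huv.periodic⟩,
      v, huv⟩
  choose T V hTV using hT
  have hest : ∀ f g : X, ∀ x, (T f).1 x - (T g).1 x ≤ (L - σ) / L * dist f g := by
    intro f g x
    have key := ((hTV f).sub (hTV g)).sub (isPeriodicC1_const ((L - σ) / L * dist f g))
    refine sub_nonpos.1 (key.nonpos (fun x _ hx => ?_) x)
    have hd : |f.1 x - g.1 x| ≤ dist f g := by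
      rw [← Real.dist_eq]
      exact BoundedContinuousFunction.dist_coe_le_dist x
    have hbound : (L * f.1 x + F (lam x) (f.1 x)) - (L * g.1 x + F (lam x) (g.1 x)) ≤
        (L - σ) * dist f g := by
      have h0 : 0 ≤ L - σ := sub_nonneg.2 hσL
      have hd' := mul_le_mul_of_nonneg_left hd h0
      rcases le_total (f.1 x) (g.1 x) with h | h
      · have := (hF _ (lam_eq_or x) _ _ h).2
        have := mul_nonneg h0 (abs_nonneg (f.1 x - g.1 x))
        linarith
      · have := (hF _ (lam_eq_or x) _ _ h).1
        rw [abs_of_nonneg (sub_nonneg.2 h)] at hd'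
        linarith
    have hx' : (L - σ) * dist f g < L * ((T f).1 x - (T g).1 x) := by
      have := mul_lt_mul_of_pos_left (sub_pos.1 hx) hL
      rwa [← mul_assoc, mul_div_cancel₀ _ hL.ne'] at this
    linarith
  have hθ : 0 ≤ (L - σ) / L := div_nonneg (sub_nonneg.2 hσL) hL.le
  have hcontr : ContractingWith ((L - σ) / L).toNNReal T := by
    refine ⟨?_, LipschitzWith.of_dist_le_mul fun f g => ?_⟩
    · rw [Real.toNNReal_lt_one, div_lt_one hL]
      linarith
    · rw [Subtype.dist_eq, Real.coe_toNNReal _ hθ]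
      refine (BoundedContinuousFunction.dist_le (mul_nonneg hθ dist_nonneg)).2 fun x => ?_
      rw [Real.dist_eq, abs_le]
      have := hest g f x
      rw [dist_comm] at this
      exact ⟨by linarith, hest f g x⟩
  have hfix : T (ContractingWith.fixedPoint T hcontr) = ContractingWith.fixedPoint T hcontr :=
    ContractingWith.fixedPoint_isFixedPt hcontr
  have := hTV (ContractingWith.fixedPoint T hcontr)
  rw [hfix] at this
  exact ⟨_, _, this.congr fun x _ => by ring⟩

/-- The method of sub- and supersolutions, with a constant supersolution. -/
lemma exists_periodic_between (G : ℝ → ℝ → ℝ) {σ L m M : ℝ} (hσ : 0 < σ) (hmM : m ≤ M)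
    (hG : ∀ s, s = 1 ∨ s = -1 → ∀ y z, m ≤ y → y ≤ z → z ≤ M →
      σ * (z - y) ≤ G s y - G s z ∧ G s y - G s z ≤ L * (z - y))
    (hM : ∀ s, s = 1 ∨ s = -1 → G s M ≤ 0)
    {u₀ v₀ w₀ : ℝ → ℝ} (h₀ : IsPeriodicC1 u₀ v₀ w₀) (hm : ∀ x, m ≤ u₀ x) (hu₀ : ∀ x, u₀ x ≤ M)
    (hw₀ : ∀ x, -G (lam x) (u₀ x) ≤ w₀ x) :
    ∃ u v, IsPeriodicC1 u v (fun x => -G (lam x) (u x)) ∧ ∀ x, m ≤ u x ∧ u x ≤ M := by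
  let c : ℝ → ℝ := fun y => max m (min y M)
  have hc : ∀ y, m ≤ y → y ≤ M → c y = y := fun y h1 h2 => by
    simp only [c, min_eq_left h2, max_eq_right h1]
  have hcm : ∀ y, m ≤ c y := fun y => le_max_left _ _
  have hcM : ∀ y, c y ≤ M := fun y => max_le hmM (min_le_right _ _)
  have hcc : ∀ y z, y ≤ z → c y ≤ c z ∧ c z - c y ≤ z - y := fun y z hyz => by
    simp only [c]
    constructor
    · gcongr
    · rcases max_cases m (min y M) with h | h <;> rcases max_cases m (min z M) with h' | h' <;>
        rcases min_cases y M with h1 | h1 <;> rcases min_cases z M with h2 | h2 <;> linarith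
  let F : ℝ → ℝ → ℝ := fun s y => G s (c y) - (y - c y)
  have hF : ∀ s, s = 1 ∨ s = -1 → ∀ y z, y ≤ z →
      min σ 1 * (z - y) ≤ F s y - F s z ∧ F s y - F s z ≤ max L 1 * (z - y) := by
    intro s hs y z hyz
    obtain ⟨h1, h2⟩ := hcc y z hyz
    obtain ⟨h3, h4⟩ := hG s hs (c y) (c z) (hcm y) h1 (hcM z)
    have h5 := mul_le_mul_of_nonneg_right (min_le_left σ 1) (sub_nonneg.2 h1)
    have h6 := mul_le_mul_of_nonneg_right (min_le_right σ 1) (sub_nonneg.2 h2)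
    have h7 := mul_le_mul_of_nonneg_right (le_max_left L 1) (sub_nonneg.2 h1)
    have h8 := mul_le_mul_of_nonneg_right (le_max_right L 1) (sub_nonneg.2 h2)
    simp only [F]
    constructor <;> linarith
  have hσ' : 0 < min σ 1 := lt_min hσ one_pos
  have hmono : ∀ x y z, y < z → F (lam x) z < F (lam x) y := fun x y z hyz => by
    have := (hF _ (lam_eq_or x) y z hyz.le).1
    have := mul_pos hσ' (sub_pos.2 hyz)
    linarith
  obtain ⟨u, v, huv⟩ := exists_periodic_of_lipschitz F hσ' hF
  have hlow : ∀ x, u₀ x ≤ u x := fun x => by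
    refine sub_nonpos.1 ((h₀.sub huv).nonpos (fun x _ hx => ?_) x)
    have h1 := hmono x _ _ (sub_pos.1 hx)
    have h2 : F (lam x) (u₀ x) = G (lam x) (u₀ x) := by
      simp only [F, hc _ (hm x) (hu₀ x), sub_self, sub_zero]
    linarith [hw₀ x]
  have hupp : ∀ x, u x ≤ M := fun x => by
    refine sub_nonpos.1 ((huv.sub (isPeriodicC1_const M)).nonpos (fun x _ hx => ?_) x)
    have h1 := hmono x _ _ (sub_pos.1 hx)
    have h2 : F (lam x) M = G (lam x) M := by
      simp only [F, hc _ hmM le_rfl, sub_self, sub_zero]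
    linarith [hM _ (lam_eq_or x)]
  have hmu : ∀ x, m ≤ u x := fun x => (hm x).trans (hlow x)
  refine ⟨u, v, huv.congr fun x _ => ?_, fun x => ⟨hmu x, hupp x⟩⟩
  simp only [F, hc _ (hmu x) (hupp x), sub_self, sub_zero]

lemma mul_sub_le_rpow_sub {p m y z : ℝ} (hp : 1 ≤ p) (hm : 0 < m) (hy : m ≤ y) (hyz : y ≤ z) :
    p * m ^ (p - 1) * (z - y) ≤ z ^ p - y ^ p := by
  have hne : ∀ x ∈ Set.Ici m, x ≠ 0 := fun x hx => (hm.trans_le hx).ne'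
  refine (convex_Ici m).mul_sub_le_image_sub_of_le_deriv (f := fun x => x ^ p)
    (fun x hx => (continuousAt_rpow_const x p (Or.inl (hne x hx))).continuousWithinAt)
    (fun x hx => (hasDerivAt_rpow_const
      (Or.inl (hne x (interior_subset hx)))).differentiableAt.differentiableWithinAt)
    (fun x hx => ?_) y hy z (hy.trans hyz) hyz
  rw [(hasDerivAt_rpow_const (Or.inl (hne x (interior_subset hx)))).deriv]
  have : m ^ (p - 1) ≤ x ^ (p - 1) :=
    rpow_le_rpow hm.le (interior_subset hx) (sub_nonneg.2 hp)
  gcongr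

lemma rpow_sub_le_mul_sub {p m M y z : ℝ} (hp : 1 ≤ p) (hm : 0 < m) (hy : m ≤ y) (hyz : y ≤ z)
    (hz : z ≤ M) : z ^ p - y ^ p ≤ p * M ^ (p - 1) * (z - y) := by
  have hne : ∀ x ∈ Set.Icc m M, x ≠ 0 := fun x hx => (hm.trans_le hx.1).ne'
  refine (convex_Icc m M).image_sub_le_mul_sub_of_deriv_le (f := fun x => x ^ p)
    (fun x hx => (continuousAt_rpow_const x p (Or.inl (hne x hx))).continuousWithinAt)
    (fun x hx => (hasDerivAt_rpow_const
      (Or.inl (hne x (interior_subset hx)))).differentiableAt.differentiableWithinAt)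
    (fun x hx => ?_) y ⟨hy, hyz.trans hz⟩ z ⟨hy.trans hyz, hz⟩ hyz
  have hx' := interior_subset hx
  rw [(hasDerivAt_rpow_const (Or.inl (hne x hx'))).deriv]
  have : x ^ (p - 1) ≤ M ^ (p - 1) :=
    rpow_le_rpow (hm.le.trans hx'.1) hx'.2 (sub_nonneg.2 hp)
  gcongr

lemma rpow_neg_sub_le_mul_sub {r m y z : ℝ} (hr : r ≤ 0) (hm : 0 < m) (hy : m ≤ y)
    (hyz : y ≤ z) : y ^ r - z ^ r ≤ -r * m ^ (r - 1) * (z - y) := by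
  have hne : ∀ x ∈ Set.Ici m, x ≠ 0 := fun x hx => (hm.trans_le hx).ne'
  have := (convex_Ici m).mul_sub_le_image_sub_of_le_deriv (f := fun x => x ^ r)
    (C := r * m ^ (r - 1))
    (fun x hx => (continuousAt_rpow_const x r (Or.inl (hne x hx))).continuousWithinAt)
    (fun x hx => (hasDerivAt_rpow_const
      (Or.inl (hne x (interior_subset hx)))).differentiableAt.differentiableWithinAt)
    (fun x hx => by
      rw [(hasDerivAt_rpow_const (Or.inl (hne x (interior_subset hx)))).deriv]
      exact mul_le_mul_of_nonpos_left
        (rpow_le_rpow_of_nonpos hm (interior_subset hx) (by linarith)) hr) y hy z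
    (hy.trans hyz) hyz
  linarith

/-- The Lichnerowicz nonlinearity with coefficients `a` and `b`. -/
noncomputable def lichG (q a b y : ℝ) : ℝ := a * y ^ (-q - 1) - b * y ^ (q - 1)

lemma mul_sub_le_lichG_sub {q a b β m y z : ℝ} (hq : 2 < q) (ha : 0 ≤ a) (hβ : 0 ≤ β)
    (hb : β ≤ b) (hm : 0 < m) (hy : m ≤ y) (hyz : y ≤ z) :
    β * ((q - 1) * m ^ (q - 2)) * (z - y) ≤ lichG q a b y - lichG q a b z := by
  have h1 := mul_sub_le_rpow_sub (p := q - 1) (by linarith) hm hy hyz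
  have h2 : z ^ (-q - 1) ≤ y ^ (-q - 1) :=
    rpow_le_rpow_of_nonpos (hm.trans_le hy) hyz (by linarith)
  rw [show q - 1 - 1 = q - 2 by ring] at h1
  have h3 : y ^ (q - 1) ≤ z ^ (q - 1) := rpow_le_rpow (by linarith) hyz (by linarith)
  have h4 := mul_le_mul_of_nonneg_left h1 hβ
  have h5 := mul_le_mul_of_nonneg_right hb (sub_nonneg.2 h3)
  have h6 := mul_le_mul_of_nonneg_left h2 ha
  unfold lichG
  linarith

lemma lichG_sub_le_mul_sub {q a b A B m M y z : ℝ} (hq : 2 < q) (ha : 0 ≤ a) (haA : a ≤ A)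
    (hb : 0 ≤ b) (hbB : b ≤ B) (hm : 0 < m) (hy : m ≤ y) (hyz : y ≤ z) (hz : z ≤ M) :
    lichG q a b y - lichG q a b z ≤
      (A * (-(-q - 1) * m ^ (-q - 1 - 1)) + B * ((q - 1) * M ^ (q - 1 - 1))) * (z - y) := by
  have h1 := rpow_sub_le_mul_sub (p := q - 1) (by linarith) hm hy hyz hz
  have h2 := rpow_neg_sub_le_mul_sub (r := -q - 1) (by linarith) hm hy hyz
  have h3 : y ^ (q - 1) ≤ z ^ (q - 1) := rpow_le_rpow (by linarith) hyz (by linarith)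
  have h4 : z ^ (-q - 1) ≤ y ^ (-q - 1) :=
    rpow_le_rpow_of_nonpos (hm.trans_le hy) hyz (by linarith)
  have h5 := mul_le_mul_of_nonneg_right haA (sub_nonneg.2 h4)
  have h6 := mul_le_mul_of_nonneg_right hbB (sub_nonneg.2 h3)
  have h7 := mul_le_mul_of_nonneg_left h2 (ha.trans haA)
  have h8 := mul_le_mul_of_nonneg_left h1 (hb.trans hbB)
  unfold lichG
  linarith

/-- A positive subsolution, uniform in the coefficients. -/
lemma exists_subsolution {q α B τ : ℝ} (hq : 2 < q) (hα : 0 < α) (hB : 0 < B)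
    (hτ : τ = 1 ∨ τ = -1) :
    ∃ m > 0, ∃ u v w, IsPeriodicC1 u v w ∧ (∀ x, m ≤ u x ∧ u x ≤ 1) ∧
      ∀ a b : ℝ → ℝ, (∀ s, s = 1 ∨ s = -1 → 0 ≤ a s ∧ b s ≤ B) → α ≤ a τ →
        ∀ x, -lichG q (a (lam x)) (b (lam x)) (u x) ≤ w x := by
  obtain ⟨p, v, hp⟩ := exists_isPeriodicC1_neg_lam
  obtain ⟨C₀, hC₀⟩ := hp.exists_abs_le
  set C := 1 + C₀
  have hC : 1 ≤ C := by
    have := (abs_nonneg _).trans (hC₀ 0)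
    simp only [C]
    linarith
  have hcont : Continuous fun ρ : ℝ => (2 * C * ρ) ^ (q - 2) :=
    (continuous_const.mul continuous_id).rpow_const fun _ => Or.inr (by linarith)
  have hev : ∀ {f : ℝ → ℝ} {c : ℝ}, Continuous f → f 0 < c → ∀ᶠ ρ in 𝓝 0, f ρ < c :=
    fun hf h => hf.continuousAt.eventually_lt_const h
  have e1 : ∀ᶠ ρ : ℝ in 𝓝 0, 2 * C * ρ < 1 := hev (by fun_prop) (by simp)
  have e2 : ∀ᶠ ρ : ℝ in 𝓝 0, 2 * C * ρ * (1 + B) < α := hev (by fun_prop) (by simpa using hα)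
  have e3 : ∀ᶠ ρ : ℝ in 𝓝 0, B * (2 * C * ρ) ^ (q - 2) * (2 * C) < 1 :=
    hev (by fun_prop) (by rw [mul_zero, zero_rpow (by linarith)]; simp)
  obtain ⟨ρ, ⟨⟨h1, h2⟩, h3⟩, hρ⟩ := (((e1.and e2).and e3).filter_mono nhdsWithin_le_nhds
    |>.and (self_mem_nhdsWithin (s := Set.Ioi (0 : ℝ)))).exists
  have hρ : 0 < ρ := hρ
  have hτ1 : |τ| = 1 := by rcases hτ with rfl | rfl <;> simp
  have hP := ((isPeriodicC1_const C).sub (hp.const_mul (-τ))).const_mul ρ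
  have hbound : ∀ x, ρ ≤ ρ * (C - -τ * p x) ∧ ρ * (C - -τ * p x) ≤ 2 * C * ρ := fun x => by
    have h := abs_mul τ (p x)
    rw [hτ1, one_mul] at h
    have := abs_le.1 (h.trans_le (hC₀ x))
    refine ⟨le_mul_of_one_le_right hρ.le (by linarith), ?_⟩
    rw [mul_comm]
    exact mul_le_mul_of_nonneg_right (by linarith) hρ.le
  refine ⟨ρ, hρ, _, _, _, hP, fun x => ⟨(hbound x).1, (hbound x).2.trans h1.le⟩, ?_⟩
  intro a b hab haτ x
  obtain ⟨y, hy⟩ : ∃ y, y = ρ * (C - -τ * p x) := ⟨_, rfl⟩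
  obtain ⟨hyl, hyu⟩ := hbound x
  rw [← hy] at hyl hyu ⊢
  have hy0 : 0 < y := hρ.trans_le hyl
  obtain ⟨ha0, hbB⟩ := hab _ (lam_eq_or x)
  have hpow : 0 ≤ y ^ (q - 1) := by positivity
  have hbB' := mul_le_mul_of_nonneg_right hbB hpow
  unfold lichG
  by_cases hx : lam x = τ
  · rw [hx] at hbB' ⊢
    have hττ : τ * τ = 1 := by rcases hτ with rfl | rfl <;> norm_num
    have h4 : 1 ≤ y ^ (-q - 1) :=
      one_le_rpow_of_pos_of_le_one_of_nonpos hy0 (by linarith) (by linarith)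
    have h5 : y ^ (q - 1) ≤ y := by
      conv_rhs => rw [← rpow_one y]
      exact rpow_le_rpow_of_exponent_ge hy0 (by linarith) (by linarith)
    have h6 : a τ ≤ a τ * y ^ (-q - 1) := le_mul_of_one_le_right (hα.le.trans haτ) h4
    have h7 := mul_le_mul_of_nonneg_left h5 hB.le
    have h8 := mul_le_mul_of_nonneg_left hyu hB.le
    have h9 : ρ * (0 - -τ * -τ) = -ρ := by linear_combination -ρ * hττ
    linarith
  · have hlam : lam x = -τ := by
      rcases hτ with rfl | rfl <;> rcases lam_eq_or x with h | h <;> simp_all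
    have hττ : τ * lam x = -1 := by
      rw [hlam]
      rcases hτ with rfl | rfl <;> norm_num
    have h4 : 0 ≤ a (lam x) * y ^ (-q - 1) := by positivity
    have h5 : y ^ (q - 1) = y ^ (q - 2) * y := by
      rw [← rpow_add_one hy0.ne']
      ring_nf
    have h6 : y ^ (q - 2) ≤ (2 * C * ρ) ^ (q - 2) := rpow_le_rpow hy0.le hyu (by linarith)
    have h7 : y ^ (q - 1) ≤ (2 * C * ρ) ^ (q - 2) * (2 * C * ρ) := by
      rw [h5]
      gcongr
    have h8 := mul_le_mul_of_nonneg_left h7 hB.le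
    have h9 := mul_le_mul_of_nonneg_right h3.le hρ.le
    have h10 : ρ * (0 - -τ * -lam x) = ρ := by linear_combination -ρ * hττ
    linarith

/-- Existence, with a lower bound uniform in the coefficient `a`. -/
lemma exists_periodic_lich {q α A τ : ℝ} {b : ℝ → ℝ} (hq : 2 < q) (hα : 0 < α)
    (hτ : τ = 1 ∨ τ = -1) (hb : ∀ s, s = 1 ∨ s = -1 → 0 < b s) :
    ∃ m > 0, ∀ a : ℝ → ℝ, (∀ s, s = 1 ∨ s = -1 → 0 ≤ a s ∧ a s ≤ A) → α ≤ a τ →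
      ∃ u v, IsPeriodicC1 u v (fun x => -lichG q (a (lam x)) (b (lam x)) (u x)) ∧
        ∀ x, m ≤ u x := by
  set β := min (b 1) (b (-1))
  set B := max (b 1) (b (-1))
  have hβ : 0 < β := lt_min (hb _ (Or.inl rfl)) (hb _ (Or.inr rfl))
  have hβb : ∀ s, s = 1 ∨ s = -1 → β ≤ b s := by
    rintro s (rfl | rfl)
    · exact min_le_left _ _
    · exact min_le_right _ _
  have hbB : ∀ s, s = 1 ∨ s = -1 → b s ≤ B := by
    rintro s (rfl | rfl)
    · exact le_max_left _ _
    · exact le_max_right _ _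
  have hB : 0 < B := hβ.trans_le ((hβb 1 (Or.inl rfl)).trans (hbB 1 (Or.inl rfl)))
  obtain ⟨m, hm, u₀, v₀, w₀, h₀, hu₀, hw₀⟩ := exists_subsolution hq hα hB hτ
  refine ⟨m, hm, fun a ha haτ => ?_⟩
  set M := max 1 (A / β)
  have hM : 1 ≤ M := le_max_left _ _
  have hmM : m ≤ M := ((hu₀ 0).1.trans (hu₀ 0).2).trans hM
  have hσ : 0 < β * ((q - 1) * m ^ (q - 2)) := by
    have : 0 < q - 1 := by linarith
    positivity
  obtain ⟨u, v, huv, hu⟩ := exists_periodic_between (fun s => lichG q (a s) (b s)) hσ hmM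
    (fun s hs y z hy hyz hz => ⟨mul_sub_le_lichG_sub hq (ha s hs).1 hβ.le (hβb s hs) hm hy hyz,
      lichG_sub_le_mul_sub hq (ha s hs).1 (ha s hs).2 (hb s hs).le (hbB s hs) hm hy hyz hz⟩)
    (fun s hs => by
      have h1 : M ^ (-q - 1) ≤ 1 := rpow_le_one_of_one_le_of_nonpos hM (by linarith)
      have h2 : M ≤ M ^ (q - 1) := by
        conv_lhs => rw [← rpow_one M]
        exact rpow_le_rpow_of_exponent_le hM (by linarith)
      have h3 : A ≤ β * M := by
        rw [← div_le_iff₀' hβ]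
        exact le_max_right _ _
      have h4 := mul_le_mul_of_nonneg_left h1 (ha s hs).1
      have h5 := mul_le_mul (hβb s hs) h2 (by linarith) (hb s hs).le
      have := (ha s hs).2
      simp only [lichG]
      linarith)
    h₀ (fun x => (hu₀ x).1) (fun x => (hu₀ x).2.trans hM)
    (hw₀ a b (fun s hs => ⟨(ha s hs).1, hbB s hs⟩) haτ)
  exact ⟨u, v, huv, fun x => (hu x).1⟩

/-- Lipschitz dependence of solutions on the coefficient `a`. -/
lemma exists_lipschitz_dependence {q m : ℝ} {b : ℝ → ℝ} (hq : 2 < q) (hm : 0 < m)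
    (hb : ∀ s, s = 1 ∨ s = -1 → 0 < b s) :
    ∃ K, ∀ (a₁ a₂ u₁ v₁ u₂ v₂ : ℝ → ℝ), (∀ s, s = 1 ∨ s = -1 → 0 ≤ a₁ s) →
      IsPeriodicC1 u₁ v₁ (fun x => -lichG q (a₁ (lam x)) (b (lam x)) (u₁ x)) →
      IsPeriodicC1 u₂ v₂ (fun x => -lichG q (a₂ (lam x)) (b (lam x)) (u₂ x)) →
      (∀ x, m ≤ u₂ x) →
      ∀ x, u₁ x - u₂ x ≤ K * (|a₁ 1 - a₂ 1| + |a₁ (-1) - a₂ (-1)|) := by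
  set β := min (b 1) (b (-1))
  have hβ : 0 < β := lt_min (hb _ (Or.inl rfl)) (hb _ (Or.inr rfl))
  have hβb : ∀ s, s = 1 ∨ s = -1 → β ≤ b s := by
    rintro s (rfl | rfl)
    · exact min_le_left _ _
    · exact min_le_right _ _
  set σ := β * ((q - 1) * m ^ (q - 2))
  have hσ : 0 < σ := by
    have : 0 < q - 1 := by linarith
    positivity
  refine ⟨m ^ (-q - 1) / σ, fun a₁ a₂ u₁ v₁ u₂ v₂ ha h₁ h₂ hu₂ x => ?_⟩
  set D := |a₁ 1 - a₂ 1| + |a₁ (-1) - a₂ (-1)|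
  have hD : 0 ≤ D := by positivity
  refine sub_nonpos.1 (((h₁.sub h₂).sub (isPeriodicC1_const _)).nonpos (fun x _ hx => ?_) x)
  have hDx : |a₁ (lam x) - a₂ (lam x)| ≤ D := by
    rcases lam_eq_or x with h | h <;> rw [h]
    · exact le_add_of_nonneg_right (abs_nonneg _)
    · exact le_add_of_nonneg_left (abs_nonneg _)
  have hpos : 0 ≤ m ^ (-q - 1) / σ * D := by positivity
  have h3 := mul_sub_le_lichG_sub hq (ha _ (lam_eq_or x)) hβ.le (hβb _ (lam_eq_or x)) hm
    (hu₂ x) (z := u₁ x) (by linarith)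
  have h4 : m ^ (-q - 1) * D < σ * (u₁ x - u₂ x) := by
    have := mul_lt_mul_of_pos_left (sub_pos.1 hx) hσ
    rwa [← mul_assoc, mul_div_cancel₀ _ hσ.ne'] at this
  have h5 : u₂ x ^ (-q - 1) ≤ m ^ (-q - 1) := rpow_le_rpow_of_nonpos hm (hu₂ x) (by linarith)
  have h6 : (a₁ (lam x) - a₂ (lam x)) * u₂ x ^ (-q - 1) ≤ D * m ^ (-q - 1) :=
    mul_le_mul ((le_abs_self _).trans hDx) h5 (rpow_nonneg (hm.le.trans (hu₂ x)) _) hD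
  have h7 : lichG q (a₁ (lam x)) (b (lam x)) (u₂ x) - lichG q (a₂ (lam x)) (b (lam x)) (u₂ x) =
      (a₁ (lam x) - a₂ (lam x)) * u₂ x ^ (-q - 1) := by
    unfold lichG
    ring
  linarith

/-- The coefficient of `φ ^ (-q - 1)` in the equation satisfied by `φ = d ψ`. -/
noncomputable def lichA (n : ℕ) (γ η μ d s : ℝ) : ℝ :=
  (2 * η ^ 2 + kap n * (μ + d ^ qex n * (γ + s)) ^ 2) / (2 * kap n * qex n)

/-- The coefficient of `φ ^ (q - 1)` in the equation satisfied by `φ = d ψ`. -/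
noncomputable def lichB (n : ℕ) (t s : ℝ) : ℝ := kap n * (t + s) ^ 2 / (2 * kap n * qex n)

lemma two_lt_qex {n : ℕ} (hn : 3 ≤ n) : 2 < qex n := by
  have : (3 : ℝ) ≤ n := by exact_mod_cast hn
  rw [qex, lt_div_iff₀ (by linarith)]
  linarith

lemma kap_pos {n : ℕ} (hn : 3 ≤ n) : 0 < kap n := by
  have : (3 : ℝ) ≤ n := by exact_mod_cast hn
  exact div_pos (by linarith) (by linarith)

lemma model_equation_iff {n : ℕ} (hn : 3 ≤ n) {t γ η μ d s y z : ℝ} (hd : 0 < d) (hy : 0 < y) :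
    -2 * kap n * qex n * d ^ (-(qex n - 2)) * z
      - 2 * η ^ 2 * d ^ (-(2 * qex n)) * y ^ (-qex n - 1)
      - kap n * (μ * d ^ (-qex n) + γ + s) ^ 2 * y ^ (-qex n - 1)
      + kap n * (t + s) ^ 2 * y ^ (qex n - 1) = 0 ↔
    d * z = -lichG (qex n) (lichA n γ η μ d s) (lichB n t s) (d * y) := by
  have hκ := kap_pos hn
  have hq : 0 < qex n := two_pos.trans (two_lt_qex hn)
  unfold lichG lichA lichB
  rw [mul_rpow hd.le hy.le, mul_rpow hd.le hy.le]
  generalize qex n = q at *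
  generalize kap n = κ at *
  have hD : 0 < d ^ q := rpow_pos_of_pos hd q
  have e1 : d ^ (-(q - 2)) = d ^ 2 / d ^ q := by
    rw [show -(q - 2) = 2 - q by ring, rpow_sub hd, rpow_two]
  have e2 : d ^ (-(2 * q)) = 1 / (d ^ q) ^ 2 := by
    rw [rpow_neg hd.le, mul_comm, rpow_mul hd.le, rpow_two, one_div]
  have e3 : d ^ (-q) = 1 / d ^ q := by rw [rpow_neg hd.le, one_div]
  have e4 : d ^ (-q - 1) = 1 / (d ^ q * d) := by
    rw [rpow_sub_one hd.ne', e3, div_div]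
  have e5 : d ^ (q - 1) = d ^ q / d := rpow_sub_one hd.ne' q
  rw [e1, e2, e3, e4, e5]
  generalize d ^ q = D at *
  generalize y ^ (-q - 1) = Y₁
  generalize y ^ (q - 1) = Y₂
  have key : -2 * κ * q * (d ^ 2 / D) * z - 2 * η ^ 2 * (1 / D ^ 2) * Y₁
      - κ * (μ * (1 / D) + γ + s) ^ 2 * Y₁ + κ * (t + s) ^ 2 * Y₂ =
      -(2 * κ * q * d / D) * (d * z -
        -((2 * η ^ 2 + κ * (μ + D * (γ + s)) ^ 2) / (2 * κ * q) * (1 / (D * d) * Y₁) -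
          κ * (t + s) ^ 2 / (2 * κ * q) * (D / d * Y₂))) := by
    field_simp
    ring
  have hne : -(2 * κ * q * d / D) ≠ 0 := neg_ne_zero.2 (by positivity)
  rw [key, mul_eq_zero, or_iff_right hne, sub_eq_zero]

lemma IsModelSolution.isPeriodicC1 {n : ℕ} (hn : 3 ≤ n) {t γ η μ d : ℝ} (hd : 0 < d)
    {ψ : ℝ → ℝ} (h : IsModelSolution n t γ η μ d ψ) :
    IsPeriodicC1 (fun x => d * ψ x) (fun x => d * deriv ψ x)
      (fun x => -lichG (qex n) (lichA n γ η μ d (lam x)) (lichB n t (lam x)) (d * ψ x)) := by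
  obtain ⟨hper, hpos, hdiff, heq⟩ := h
  have h₁ : IsPeriodicC1 ψ (deriv ψ) (deriv (deriv ψ)) :=
    { periodic := hper
      hasDerivAt := fun x => (hdiff.differentiable one_ne_zero x).hasDerivAt
      continuous_deriv := hdiff.continuous_deriv le_rfl
      hasDerivAt_deriv := fun x hx =>
        (heq x fun k hk => hx (sin_eq_zero_iff.2 ⟨k, hk.symm⟩)).1.hasDerivAt }
  exact (h₁.const_mul d).congr fun x hx => (model_equation_iff hn hd (hpos x)).1
    (heq x fun k hk => hx (sin_eq_zero_iff.2 ⟨k, hk.symm⟩)).2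

lemma IsPeriodicC1.isModelSolution {n : ℕ} (hn : 3 ≤ n) {t γ η μ d : ℝ} (hd : 0 < d)
    {u v : ℝ → ℝ} (hpos : ∀ x, 0 < u x)
    (h : IsPeriodicC1 u v
      (fun x => -lichG (qex n) (lichA n γ η μ d (lam x)) (lichB n t (lam x)) (u x))) :
    IsModelSolution n t γ η μ d (fun x => d⁻¹ * u x) := by
  have h₁ := h.const_mul d⁻¹
  have hderiv : deriv (fun x => d⁻¹ * u x) = fun x => d⁻¹ * v x :=
    funext fun x => (h₁.hasDerivAt x).deriv
  refine ⟨h₁.periodic, fun x => mul_pos (inv_pos.2 hd) (hpos x), ?_, fun x hx => ?_⟩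
  · rw [contDiff_one_iff_deriv, hderiv]
    exact ⟨fun x => (h₁.hasDerivAt x).differentiableAt, h₁.continuous_deriv⟩
  · have hs : sin x ≠ 0 := fun h0 => by
      obtain ⟨k, hk⟩ := sin_eq_zero_iff.1 h0
      exact hx k hk.symm
    have h₂ := h₁.hasDerivAt_deriv x hs
    rw [hderiv]
    refine ⟨h₂.differentiableAt, ?_⟩
    rw [h₂.deriv, model_equation_iff hn hd (mul_pos (inv_pos.2 hd) (hpos x)),
      mul_inv_cancel_left₀ hd.ne', mul_inv_cancel_left₀ hd.ne']

lemma IsPeriodicC1.exists_pos_le {u v w : ℝ → ℝ} (h : IsPeriodicC1 u v w)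
    (hpos : ∀ x, 0 < u x) : ∃ m > 0, ∀ x, m ≤ u x := by
  obtain ⟨x₀, -, hmin⟩ := (isCompact_Icc (a := (0 : ℝ)) (b := 2 * π)).exists_isMinOn
    ⟨0, by constructor <;> [exact le_rfl; positivity]⟩ h.continuous.continuousOn
  refine ⟨u x₀, hpos x₀, fun x => ?_⟩
  obtain ⟨z, hz, hxz⟩ := h.periodic.exists_mem_Ico₀ (by positivity) x
  rw [hxz]
  exact hmin ⟨hz.1, hz.2.le⟩

lemma lichB_pos {n : ℕ} (hn : 3 ≤ n) {t : ℝ} (ht : |t| ≠ 1) {s : ℝ} (hs : s = 1 ∨ s = -1) :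
    0 < lichB n t s := by
  have hκ := kap_pos hn
  have hq : 0 < qex n := two_pos.trans (two_lt_qex hn)
  have hts : t + s ≠ 0 := fun h => ht <| by
    rw [eq_neg_of_add_eq_zero_left h]
    rcases hs with rfl | rfl <;> simp
  unfold lichB
  positivity

lemma continuous_lichA {n : ℕ} (hn : 3 ≤ n) (γ η μ s : ℝ) :
    Continuous fun d => lichA n γ η μ d s := by
  have hq : 0 ≤ qex n := (two_pos.trans (two_lt_qex hn)).le
  have : Continuous fun d : ℝ => d ^ qex n := continuous_id.rpow_const fun _ => Or.inr hq
  unfold lichA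
  fun_prop

lemma lichA_nonneg {n : ℕ} (hn : 3 ≤ n) (γ η μ d s : ℝ) : 0 ≤ lichA n γ η μ d s := by
  have hκ := kap_pos hn
  have hq : 0 < qex n := two_pos.trans (two_lt_qex hn)
  unfold lichA
  positivity

/-- On one of the two half-periods the coefficient `lichA` is bounded below uniformly in `d`. -/
lemma exists_lichA_ge {n : ℕ} (hn : 3 ≤ n) {γ η μ : ℝ} (hγ : -1 < γ ∧ γ < 1)
    (hTT : η ≠ 0 ∨ μ ≠ 0) : ∃ τ, (τ = 1 ∨ τ = -1) ∧ ∃ α > 0, ∀ d, 0 ≤ d →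
      α ≤ lichA n γ η μ d τ := by
  have hκ := kap_pos hn
  have hq : 0 < qex n := two_pos.trans (two_lt_qex hn)
  obtain ⟨τ, hτ, hμτ⟩ : ∃ τ : ℝ, (τ = 1 ∨ τ = -1) ∧ 0 ≤ μ * (γ + τ) := by
    rcases le_total 0 μ with h | h
    · exact ⟨1, Or.inl rfl, mul_nonneg h (by linarith)⟩
    · exact ⟨-1, Or.inr rfl, mul_nonneg_of_nonpos_of_nonpos h (by linarith)⟩
  refine ⟨τ, hτ, (2 * η ^ 2 + kap n * μ ^ 2) / (2 * kap n * qex n), ?_, fun d hd => ?_⟩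
  · have : 0 < 2 * η ^ 2 + kap n * μ ^ 2 := by
      rcases hTT with h | h <;> positivity
    positivity
  · have hD : 0 ≤ d ^ qex n := rpow_nonneg hd _
    have : μ ^ 2 ≤ (μ + d ^ qex n * (γ + τ)) ^ 2 := by
      have := mul_nonneg hD hμτ
      have := sq_nonneg (d ^ qex n * (γ + τ))
      linarith
    unfold lichA
    gcongr

/-- A value ≤ 1 suffices for existence (Lemma 3.13). -/
theorem value_le_one_suffices (n : ℕ) (hn : 3 ≤ n) (t γ η μ : ℝ)
    (hγ : -1 < γ ∧ γ < 1) (hTT : η ≠ 0 ∨ μ ≠ 0) (ht : |t| ≠ 1)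
    (h : ∃ d : ℝ, 0 < d ∧ ∃ ψ : ℝ → ℝ, IsModelSolution n t γ η μ d ψ ∧ ψ 0 ≤ 1) :
    ∃ d' : ℝ, 0 < d' ∧ ∃ ψ' : ℝ → ℝ, IsModelSolution n t γ η μ d' ψ' ∧ ψ' 0 = 1 := by
  obtain ⟨d₁, hd₁, ψ, hψ, hψ0⟩ := h
  have hq := two_lt_qex hn
  have hb : ∀ s, s = 1 ∨ s = -1 → 0 < lichB n t s := fun s hs => lichB_pos hn ht hs
  obtain ⟨τ, hτ, α, hα, hατ⟩ := exists_lichA_ge hn hγ hTT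
  obtain ⟨A₁, hA₁⟩ := isCompact_Icc.bddAbove_image
    (continuous_lichA hn γ η μ 1).continuousOn (K := Set.Icc 0 d₁)
  obtain ⟨A₂, hA₂⟩ := isCompact_Icc.bddAbove_image
    (continuous_lichA hn γ η μ (-1)).continuousOn (K := Set.Icc 0 d₁)
  obtain ⟨m, hm, hex⟩ := exists_periodic_lich (A := max A₁ A₂) hq hα hτ hb
  have hsol : ∀ d, ∃ u v, d ∈ Set.Icc 0 d₁ → IsPeriodicC1 u v
      (fun x => -lichG (qex n) (lichA n γ η μ d (lam x)) (lichB n t (lam x)) (u x)) ∧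
        ∀ x, m ≤ u x := fun d => by
    by_cases hd : d ∈ Set.Icc 0 d₁
    · obtain ⟨u, v, huv⟩ := hex (lichA n γ η μ d) (fun s hs => ⟨lichA_nonneg hn γ η μ d s, by
        rcases hs with rfl | rfl
        · exact le_max_of_le_left (hA₁ ⟨d, hd, rfl⟩)
        · exact le_max_of_le_right (hA₂ ⟨d, hd, rfl⟩)⟩) (hατ d hd.1)
      exact ⟨u, v, fun _ => huv⟩
    · exact ⟨0, 0, fun h => absurd h hd⟩
  choose u v huv using hsol
  have hcont : ContinuousOn (fun d => u d 0) (Set.Icc 0 d₁) := by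
    obtain ⟨K, hK⟩ := exists_lipschitz_dependence hq hm hb
    intro d₀ hd₀
    rw [ContinuousWithinAt, tendsto_iff_dist_tendsto_zero]
    have hlim : Tendsto (fun d => K * (|lichA n γ η μ d 1 - lichA n γ η μ d₀ 1| +
        |lichA n γ η μ d (-1) - lichA n γ η μ d₀ (-1)|)) (𝓝[Set.Icc 0 d₁] d₀) (𝓝 0) := by
      have h1 := continuous_lichA hn γ η μ 1
      have h2 := continuous_lichA hn γ η μ (-1)
      have h3 : Continuous (fun d => K * (|lichA n γ η μ d 1 - lichA n γ η μ d₀ 1| +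
        |lichA n γ η μ d (-1) - lichA n γ η μ d₀ (-1)|)) := by fun_prop
      have h4 := h3.tendsto d₀
      simp only [sub_self, abs_zero, add_zero, mul_zero] at h4
      exact h4.mono_left nhdsWithin_le_nhds
    refine squeeze_zero' (Eventually.of_forall fun _ => dist_nonneg) ?_ hlim
    filter_upwards [self_mem_nhdsWithin] with d hd
    have h1 := hK _ _ _ _ _ _ (fun s _ => lichA_nonneg hn γ η μ d s) (huv d hd).1
      (huv d₀ hd₀).1 (huv d₀ hd₀).2 0
    have h2 := hK _ _ _ _ _ _ (fun s _ => lichA_nonneg hn γ η μ d₀ s) (huv d₀ hd₀).1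
      (huv d hd).1 (huv d hd).2 0
    rw [abs_sub_comm, abs_sub_comm (lichA n γ η μ d₀ (-1))] at h2
    rw [Real.dist_eq, abs_le]
    exact ⟨by linarith, h1⟩
  have hle : u d₁ 0 ≤ d₁ := by
    have hd₁' : d₁ ∈ Set.Icc 0 d₁ := ⟨hd₁.le, le_rfl⟩
    have hU := hψ.isPeriodicC1 hn hd₁
    obtain ⟨m', hm', hUm⟩ := hU.exists_pos_le fun x => mul_pos hd₁ (hψ.2.1 x)
    obtain ⟨K, hK⟩ := exists_lipschitz_dependence hq hm' hb
    have h1 := hK _ _ _ _ _ _ (fun s _ => lichA_nonneg hn γ η μ d₁ s) (huv d₁ hd₁').1 hU hUm 0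
    simp only [sub_self, abs_zero, add_zero, mul_zero] at h1
    have := mul_le_of_le_one_right hd₁.le hψ0
    linarith
  set d₀ := min d₁ m
  have hd₀ : 0 < d₀ := lt_min hd₁ hm
  have hd₀₁ : d₀ ≤ d₁ := min_le_left _ _
  have hge : d₀ ≤ u d₀ 0 := (min_le_right _ _).trans ((huv d₀ ⟨hd₀.le, hd₀₁⟩).2 0)
  have hsub : Set.Icc d₀ d₁ ⊆ Set.Icc 0 d₁ := Set.Icc_subset_Icc_left hd₀.le
  obtain ⟨d, hd, hd0⟩ := intermediate_value_Icc' hd₀₁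
    ((hcont.mono hsub).sub continuousOn_id)
    (show (0 : ℝ) ∈ Set.Icc _ _ from ⟨sub_nonpos.2 hle, sub_nonneg.2 hge⟩)
  have hdpos : 0 < d := hd₀.trans_le hd.1
  obtain ⟨hP, hmd⟩ := huv d (hsub hd)
  refine ⟨d, hdpos, _, hP.isModelSolution hn hdpos fun x => hm.trans_le (hmd x), ?_⟩
  rw [show u d 0 = d from sub_eq_zero.1 hd0, inv_mul_cancel₀ hdpos.ne']
end

section
/- Resolvent estimate for the singularly perturbed Schrödinger operator on the circle (Proposition 4.8): Let p > 1 and let 0 < m ≤ M. There exists a constant C > 0, depending only on p, m and M, such that for every ε with 0 < ε < min(1, √m), every measurable 2π-periodic function V : ℝ → ℝ with m ≤ V(x) ≤ M for almost every x, and every 2π-periodic twice continuously differentiable function u : ℝ → ℝ, setting f = −ε² u'' + V·u, one has (∫_{−π}^{π} |u|^p)^{1/p} + (∫_{−π}^{π} |u'|^p)^{1/p} + (∫_{−π}^{π} |u''|^p)^{1/p} ≤ C ε^{−4} (∫_{−π}^{π} |f|^p)^{1/p}. -/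
open Real MeasureTheory

section LpNorm

variable {α : Type*} [MeasurableSpace α] {μ : Measure α} [IsFiniteMeasure μ]

lemma lpNorm_le_of_ae_bound {f : α → ℝ} {q : ENNReal} {c : ℝ} (hc : 0 ≤ c)
    (hf : AEStronglyMeasurable f μ) (hfc : ∀ᵐ x ∂μ, ‖f x‖ ≤ c) :
    lpNorm f q μ ≤ c * μ.real Set.univ ^ q.toReal⁻¹ := by
  rw [← toReal_eLpNorm hf]
  refine (ENNReal.toReal_mono ?_ (eLpNorm_le_of_ae_bound (p := q) hfc)).trans_eq ?_
  · finiteness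
  · rw [ENNReal.toReal_mul, ENNReal.toReal_ofReal hc, ← ENNReal.toReal_rpow, mul_comm]
    rfl

lemma integral_norm_le_lpNorm_mul {f : α → ℝ} {q : ENNReal} (hq : 1 ≤ q) (hf : MemLp f q μ) :
    ∫ x, ‖f x‖ ∂μ ≤ lpNorm f q μ * μ.real Set.univ ^ (1 - q.toReal⁻¹) := by
  rw [← lpNorm_one_eq_integral_norm hf.1, ← toReal_eLpNorm hf.1, ← toReal_eLpNorm hf.1]
  have hexp : (0 : ℝ) ≤ 1 - 1 / q.toReal := by
    rcases eq_or_ne q ⊤ with rfl | hq'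
    · simp
    · have : 1 ≤ q.toReal := by simpa using ENNReal.toReal_mono hq' hq
      rw [sub_nonneg, div_le_one (by linarith)]
      exact this
  have h := eLpNorm_le_eLpNorm_mul_rpow_measure_univ hq hf.1
  rw [ENNReal.toReal_one, div_one] at h
  refine (ENNReal.toReal_mono ?_ h).trans_eq ?_
  · exact ENNReal.mul_ne_top hf.eLpNorm_ne_top
      (ENNReal.rpow_ne_top_of_nonneg hexp (measure_ne_top _ _))
  · rw [ENNReal.toReal_mul, ← ENNReal.toReal_rpow, one_div]
    rfl

end LpNorm

section Calculus

/-- A function differs between two points of an interval by at most the total variation. -/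
lemma abs_sub_le_integral_abs_of_hasDerivAt {g g' : ℝ → ℝ} {a b x y : ℝ}
    (hg : ∀ t, HasDerivAt g (g' t) t) (hg' : Continuous g')
    (hx : x ∈ Set.Icc a b) (hy : y ∈ Set.Icc a b) :
    |g x - g y| ≤ ∫ t in a..b, |g' t| := by
  wlog hyx : y ≤ x generalizing x y
  · rw [abs_sub_comm]
    exact this hy hx (le_of_not_ge hyx)
  rw [← intervalIntegral.integral_eq_sub_of_hasDerivAt (fun t _ ↦ hg t)
    (hg'.intervalIntegrable _ _)]
  refine (intervalIntegral.abs_integral_le_integral_abs hyx).trans ?_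
  exact intervalIntegral.integral_mono_interval hy.1 hyx hx.2
    (Filter.Eventually.of_forall fun t ↦ abs_nonneg _) (hg'.abs.intervalIntegrable _ _)

/-- The Sobolev embedding of `H¹` into the bounded functions on an interval of length at
least one. -/
lemma sq_le_two_mul_integral_sq_add_sq {g g' : ℝ → ℝ} {a b x : ℝ} (hab : 1 ≤ b - a)
    (hg : ∀ t, HasDerivAt g (g' t) t) (hg' : Continuous g') (hx : x ∈ Set.Icc a b) :
    g x ^ 2 ≤ 2 * ∫ t in a..b, (g t ^ 2 + g' t ^ 2) := by
  have hgc : Continuous g := continuous_iff_continuousAt.2 fun t ↦ (hg t).continuousAt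
  have hle : a ≤ b := by linarith
  obtain ⟨y, hy, hmin⟩ := isCompact_Icc.exists_isMinOn (Set.nonempty_Icc.2 hle)
    (hgc.pow 2).continuousOn
  have hsum : Continuous fun t ↦ g t ^ 2 + g' t ^ 2 := by fun_prop
  have h1 : g y ^ 2 ≤ ∫ t in a..b, (g t ^ 2 + g' t ^ 2) := by
    have h := intervalIntegral.integral_mono_on (μ := volume) hle
      (_root_.intervalIntegrable_const (c := g y ^ 2))
      (hsum.intervalIntegrable a b) (fun t ht ↦ by
        have : g y ^ 2 ≤ g t ^ 2 := isMinOn_iff.1 hmin t ht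
        nlinarith [sq_nonneg (g' t)])
    rw [intervalIntegral.integral_const, smul_eq_mul] at h
    nlinarith [sq_nonneg (g y)]
  have h2 : |g x ^ 2 - g y ^ 2| ≤ ∫ t in a..b, |2 * g t * g' t| :=
    abs_sub_le_integral_abs_of_hasDerivAt (g := fun t ↦ g t ^ 2)
      (fun t ↦ by simpa using (hg t).fun_pow 2) (by fun_prop) hx hy
  have h3 : ∫ t in a..b, |2 * g t * g' t| ≤ ∫ t in a..b, (g t ^ 2 + g' t ^ 2) := by
    refine intervalIntegral.integral_mono_on hle (Continuous.intervalIntegrable (by fun_prop) _ _)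
      (hsum.intervalIntegrable _ _) fun t _ ↦ abs_le.2 ⟨?_, ?_⟩
    · nlinarith [sq_nonneg (g t + g' t)]
    · nlinarith [sq_nonneg (g t - g' t)]
  linarith [le_abs_self (g x ^ 2 - g y ^ 2)]

lemma deriv_add_period {g : ℝ → ℝ} {T : ℝ} (hg : ∀ x, g (x + T) = g x) (x : ℝ) :
    deriv g (x + T) = deriv g x := by
  rw [← deriv_comp_add_const, funext hg]

end Calculus

/-- The sup bound obtained by testing `-ε² u'' + V u = f` against `u`. -/
lemma abs_le_two_mul_integral_of_schrodinger {a b m M ε : ℝ} {V u u' u'' : ℝ → ℝ}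
    (hab : 1 ≤ b - a) (hε : 0 < ε) (hεm : ε ^ 2 ≤ m) (hV : Measurable V)
    (hVm : ∀ᵐ x : ℝ, m ≤ V x ∧ V x ≤ M)
    (hu : ∀ x, HasDerivAt u (u' x) x) (hu' : ∀ x, HasDerivAt u' (u'' x) x)
    (hu'' : Continuous u'') (hper : u b = u a) (hper' : u' b = u' a)
    {x : ℝ} (hx : x ∈ Set.Icc a b) :
    |u x| ≤ 2 * (ε ^ 2)⁻¹ * ∫ t in a..b, |-ε ^ 2 * u'' t + V t * u t| := by
  have huc : Continuous u := continuous_iff_continuousAt.2 fun t ↦ (hu t).continuousAt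
  have huc' : Continuous u' := continuous_iff_continuousAt.2 fun t ↦ (hu' t).continuousAt
  have hle : a ≤ b := by linarith
  have hVi : IntervalIntegrable V volume a b := by
    rw [intervalIntegrable_iff_integrableOn_Ioc_of_le hle]
    refine Integrable.of_bound (C := max |m| |M|) hV.aestronglyMeasurable ?_
    filter_upwards [ae_restrict_of_ae hVm] with t ht
    exact abs_le_max_abs_abs ht.1 ht.2
  have hVu : IntervalIntegrable (fun t ↦ V t * u t) volume a b :=
    hVi.mul_continuousOn huc.continuousOn
  set f : ℝ → ℝ := fun t ↦ -ε ^ 2 * u'' t + V t * u t with hf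
  have hfi : IntervalIntegrable f volume a b :=
    (Continuous.intervalIntegrable (by fun_prop) _ _).add hVu
  obtain ⟨y, hy, hmax⟩ := isCompact_Icc.exists_isMaxOn (Set.nonempty_Icc.2 hle)
    huc.abs.continuousOn
  have hmax := isMaxOn_iff.1 hmax
  set E := ∫ t in a..b, (u t ^ 2 + u' t ^ 2) with hE
  have hsob : u y ^ 2 ≤ 2 * E := sq_le_two_mul_integral_sq_add_sq hab hu huc' hy
  have hparts : ∫ t in a..b, u t * u'' t = - ∫ t in a..b, u' t * u' t := by
    rw [intervalIntegral.integral_mul_deriv_eq_deriv_mul (fun t _ ↦ hu t) (fun t _ ↦ hu' t)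
      (huc'.intervalIntegrable _ _) (hu''.intervalIntegrable _ _), hper, hper']
    ring
  have hfu : IntervalIntegrable (fun t ↦ f t * u t) volume a b :=
    hfi.mul_continuousOn huc.continuousOn
  have henergy : ε ^ 2 * E ≤ ∫ t in a..b, f t * u t := by
    have hcross : ∫ t in a..b, ε ^ 2 * (u' t * u' t + u t * u'' t) = 0 := by
      rw [intervalIntegral.integral_const_mul, intervalIntegral.integral_add
        (Continuous.intervalIntegrable (by fun_prop) _ _)
        (Continuous.intervalIntegrable (by fun_prop) _ _), hparts]
      ring
    have hcrossi : IntervalIntegrable (fun t ↦ ε ^ 2 * (u' t * u' t + u t * u'' t)) volume a b :=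
      Continuous.intervalIntegrable (by fun_prop) _ _
    rw [← add_zero (∫ t in a..b, f t * u t), ← hcross, ← intervalIntegral.integral_add hfu hcrossi,
      hE, ← intervalIntegral.integral_const_mul]
    refine intervalIntegral.integral_mono_ae hle (Continuous.intervalIntegrable (by fun_prop) _ _)
      (hfu.add hcrossi) ?_
    filter_upwards [hVm] with t ht
    have := mul_le_mul_of_nonneg_right (hεm.trans ht.1) (sq_nonneg (u t))
    simp only [hf]
    nlinarith
  have hupper : ∫ t in a..b, f t * u t ≤ |u y| * ∫ t in a..b, |f t| := by
    rw [← intervalIntegral.integral_const_mul]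
    refine intervalIntegral.integral_mono_on hle hfu (hfi.abs.const_mul _) fun t ht ↦ ?_
    refine (le_abs_self _).trans ?_
    rw [abs_mul, mul_comm]
    exact mul_le_mul_of_nonneg_right (hmax t ht) (abs_nonneg _)
  have hI : 0 ≤ ∫ t in a..b, |f t| :=
    intervalIntegral.integral_nonneg hle fun t _ ↦ abs_nonneg _
  refine (hmax x hx).trans ?_
  have hε2 : 0 < ε ^ 2 := by positivity
  have key : |u y| * (ε ^ 2 * |u y|) ≤ |u y| * (2 * ∫ t in a..b, |f t|) := by
    have := mul_le_mul_of_nonneg_left hsob hε2.le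
    rw [← sq_abs (u y)] at this
    linarith
  rcases (abs_nonneg (u y)).eq_or_lt with h0 | h0
  · rw [← h0]
    positivity
  · have := le_of_mul_le_mul_left key h0
    rw [mul_right_comm, ← div_eq_mul_inv, le_div_iff₀ hε2]
    linarith



/-- Resolvent estimate for the singularly perturbed Schrödinger operator on the
circle (Proposition 4.8). -/
theorem resolvent_estimate (p : ℝ) (hp : 1 < p) (m M : ℝ) (hm : 0 < m) (hmM : m ≤ M) :
    ∃ C : ℝ, 0 < C ∧
      ∀ ε : ℝ, 0 < ε → ε < min 1 (Real.sqrt m) →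
        ∀ V : ℝ → ℝ, Measurable V → (∀ x, V (x + 2 * Real.pi) = V x) →
          (∀ᵐ x : ℝ ∂volume, m ≤ V x ∧ V x ≤ M) →
          ∀ u : ℝ → ℝ, (∀ x, u (x + 2 * Real.pi) = u x) → ContDiff ℝ 2 u →
            (∫ x in (-Real.pi)..Real.pi, |u x| ^ p) ^ (1 / p)
              + (∫ x in (-Real.pi)..Real.pi, |deriv u x| ^ p) ^ (1 / p)
              + (∫ x in (-Real.pi)..Real.pi, |deriv (deriv u) x| ^ p) ^ (1 / p)
            ≤ C * ε ^ (-(4 : ℝ)) *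
              (∫ x in (-Real.pi)..Real.pi,
                  |(-ε ^ 2 * deriv (deriv u) x + V x * u x)| ^ p) ^ (1 / p) := by
  set q : ENNReal := ENNReal.ofReal p with hq
  have hqp : q.toReal = p := ENNReal.toReal_ofReal (by linarith)
  have hq1 : 1 ≤ q := by rw [hq, ENNReal.one_le_ofReal]; exact hp.le
  have hpi : -π ≤ π := by linarith [pi_pos]
  set μ : Measure ℝ := volume.restrict (Set.Ioc (-π) π) with hμ
  set K : ℝ := μ.real Set.univ ^ p⁻¹ with hK
  set L : ℝ := μ.real Set.univ ^ (1 - p⁻¹) with hL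
  have hK0 : 0 ≤ K := by positivity
  have hL0 : 0 ≤ L := by positivity
  have hM : 0 < M := hm.trans_le hmM
  refine ⟨2 * K * L + (L * K + 1) * (1 + 2 * M * K * L), by positivity, ?_⟩
  intro ε hε hεm V hV _ hVm u hper hu
  have hnorm (g : ℝ → ℝ) (hg : AEStronglyMeasurable g μ) :
      (∫ x in (-π)..π, |g x| ^ p) ^ (1 / p) = lpNorm g q μ := by
    rw [lpNorm_eq_integral_norm_rpow_toReal (by positivity) ENNReal.ofReal_ne_top hg, hqp,
      intervalIntegral.integral_of_le hpi, one_div]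
    rfl
  have hd : Differentiable ℝ u := hu.differentiable (by norm_num)
  have hu1 : ContDiff ℝ 1 (deriv u) := (contDiff_succ_iff_deriv (n := 1).1 hu).2.2
  have hd' : Differentiable ℝ (deriv u) := hu1.differentiable (by norm_num)
  have hc'' : Continuous (deriv (deriv u)) := hu1.continuous_deriv le_rfl
  have hend (g : ℝ → ℝ) (hg : ∀ x, g (x + 2 * π) = g x) : g π = g (-π) := by
    rw [← hg (-π)]
    ring_nf
  have hε1 : ε < 1 := hεm.trans_le (min_le_left _ _)
  have hεm' : ε ^ 2 ≤ m := by
    have := (Real.lt_sqrt hε.le).1 (hεm.trans_le (min_le_right _ _))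
    exact this.le
  set f : ℝ → ℝ := fun x ↦ -ε ^ 2 * deriv (deriv u) x + V x * u x with hf
  have hfm : AEStronglyMeasurable f μ :=
    ((hc''.measurable.const_mul _).add (hV.mul hd.continuous.measurable)).aestronglyMeasurable
  rw [hnorm u hd.continuous.aestronglyMeasurable, hnorm _ hd'.continuous.aestronglyMeasurable,
    hnorm _ hc''.aestronglyMeasurable, hnorm f hfm]
  set F := lpNorm f q μ with hF
  set N := lpNorm (deriv (deriv u)) q μ with hN
  set s : ℝ := (ε ^ 2)⁻¹ with hs
  have hs0 : 0 < s := by positivity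
  have hs1 : 1 ≤ s := (one_le_inv₀ (by positivity)).2 (by nlinarith)
  have hs4 : ε ^ (-(4 : ℝ)) = s * s := by
    rw [Real.rpow_neg hε.le, hs, ← mul_inv]
    norm_cast
    ring
  have hF0 : 0 ≤ F := lpNorm_nonneg
  have hN0 : 0 ≤ N := lpNorm_nonneg
  have hIcc : ∀ᵐ x ∂μ, x ∈ Set.Icc (-π) π :=
    (ae_restrict_mem measurableSet_Ioc).mono fun x hx ↦ Set.Ioc_subset_Icc_self hx
  have hmem (g : ℝ → ℝ) (hg : Continuous g) : MemLp g q μ := by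
    obtain ⟨c, hc⟩ := isCompact_Icc.exists_bound_of_continuousOn
      (hg.continuousOn (s := Set.Icc (-π) π))
    exact MemLp.of_bound hg.aestronglyMeasurable c (hIcc.mono hc)
  set A : ℝ := 2 * s * (F * L) with hA
  have hA0 : 0 ≤ A := by positivity
  have hVum : AEStronglyMeasurable (fun x ↦ V x * u x) μ :=
    (hV.mul hd.continuous.measurable).aestronglyMeasurable
  have hVu_mem : MemLp (fun x ↦ V x * u x) q μ := by
    refine (hmem _ hd.continuous).of_le_mul (c := M) hVum ?_
    filter_upwards [ae_restrict_of_ae hVm] with x hx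
    rw [norm_mul, Real.norm_of_nonneg (hm.le.trans hx.1)]
    exact mul_le_mul_of_nonneg_right hx.2 (norm_nonneg _)
  have hf_mem : MemLp f q μ :=
    (hmem (fun x ↦ -ε ^ 2 * deriv (deriv u) x) (by fun_prop)).add hVu_mem
  have hint (g : ℝ → ℝ) (hg : MemLp g q μ) : ∫ x in (-π)..π, |g x| ≤ lpNorm g q μ * L := by
    have := integral_norm_le_lpNorm_mul hq1 hg
    rw [intervalIntegral.integral_of_le hpi]
    rwa [hqp] at this
  have huA (x : ℝ) (hx : x ∈ Set.Icc (-π) π) : |u x| ≤ A := by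
    refine (abs_le_two_mul_integral_of_schrodinger (by linarith [pi_gt_three]) hε hεm' hV hVm
      (fun x ↦ (hd x).hasDerivAt) (fun x ↦ (hd' x).hasDerivAt) hc'' (hend _ hper)
      (hend _ (deriv_add_period hper)) hx).trans ?_
    exact mul_le_mul_of_nonneg_left (hint f hf_mem) (by positivity)
  have hu'B (x : ℝ) (hx : x ∈ Set.Icc (-π) π) : |deriv u x| ≤ N * L := by
    obtain ⟨y, hy, hy0⟩ := exists_deriv_eq_zero (by linarith [pi_pos]) hd.continuous.continuousOn
      (hend _ hper).symm
    have := abs_sub_le_integral_abs_of_hasDerivAt (fun x ↦ (hd' x).hasDerivAt) hc'' hx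
      (Set.Ioo_subset_Icc_self hy)
    rw [hy0, sub_zero] at this
    exact this.trans (hint _ (hmem _ hc''))
  have h0 : lpNorm u q μ ≤ A * K := by
    have := lpNorm_le_of_ae_bound (q := q) hA0 hd.continuous.aestronglyMeasurable (hIcc.mono huA)
    rwa [hqp] at this
  have h1 : lpNorm (deriv u) q μ ≤ N * L * K := by
    have := lpNorm_le_of_ae_bound (q := q) (mul_nonneg hN0 hL0)
      hd'.continuous.aestronglyMeasurable (hIcc.mono hu'B)
    rwa [hqp] at this
  have h2 : lpNorm (fun x ↦ V x * u x) q μ ≤ M * A * K := by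
    have := lpNorm_le_of_ae_bound (q := q) (c := M * A) (by positivity) hVum (by
      filter_upwards [hIcc, ae_restrict_of_ae hVm] with x hx hx'
      rw [norm_mul, Real.norm_of_nonneg (hm.le.trans hx'.1)]
      exact mul_le_mul hx'.2 (huA x hx) (norm_nonneg _) hM.le)
    rwa [hqp] at this
  have h3 : N ≤ s * (F + M * A * K) := by
    have heq : deriv (deriv u) = s • ((fun x ↦ V x * u x) - f) := by
      ext x
      simp only [hf, hs, Pi.smul_apply, Pi.sub_apply, smul_eq_mul]
      field_simp
      ring
    rw [hN, heq, lpNorm_const_smul, coe_nnnorm, Real.norm_of_nonneg hs0.le]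
    refine mul_le_mul_of_nonneg_left ((lpNorm_sub_le hVu_mem hq1).trans ?_) hs0.le
    linarith
  have h4 : N ≤ (1 + 2 * M * K * L) * (s * s * F) := by
    refine h3.trans ?_
    have : s * F ≤ s * s * F := by
      refine mul_le_mul_of_nonneg_right ?_ hF0
      nlinarith
    rw [hA]
    linarith
  have h5 : A * K ≤ 2 * K * L * (s * s * F) := by
    have : s * F ≤ s * s * F := by
      refine mul_le_mul_of_nonneg_right ?_ hF0
      nlinarith
    have := mul_le_mul_of_nonneg_left this (show 0 ≤ 2 * K * L by positivity)
    rw [hA]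
    linarith
  have h6 := mul_le_mul_of_nonneg_left h4 (show 0 ≤ L * K + 1 by positivity)
  rw [hs4]
  linarith
end
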